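/- Let G be a finite abelian group of odd order and let p be the smallest prime divisor of |G|. Assume |G|/p is composite, and that |G|/p ≥ 62 if p = 3, and |G|/p ≥ 7p + 3 if p ≥ 5. Let A be a subset of G \ {0} of cardinality cr(G) − 1 such that Σ(A) ≠ G. Then there exist a subgroup H of G of order |G|/p and an element g ∈ G \ H such that H \ {0} ⊆ A and A ⊆ H ∪ (g + H) ∪ (−g + H). -/

import Mathlib

open Finset

/-- The set of all nonempty subset sums of a finite set `A`. -/
def nss {G : Type*} [AddCommGroup G] [DecidableEq G] (A : Finset G) : Finset G :=
  (A.powerset.erase ∅).image fun B => B.sum id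

/-- The critical number of a finite abelian group `G`. -/
noncomputable def cr (G : Type*) [AddCommGroup G] [Fintype G] [DecidableEq G] : ℕ :=
  sInf {ℓ : ℕ | 0 < ℓ ∧ ∀ A : Finset G, (0 : G) ∉ A → ℓ ≤ A.card → nss A = Finset.univ}

section Auxiliary

open scoped Pointwise

variable {G : Type*} [AddCommGroup G] [Fintype G] [DecidableEq G]

/-- Every proper subgroup of a finite abelian group lies in a subgroup of prime index. -/
lemma exists_le_prime_index {G : Type*} [AddCommGroup G] [Finite G] {K : AddSubgroup G}
    (hK : K ≠ ⊤) : ∃ L : AddSubgroup G, K ≤ L ∧ L.index.Prime := by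
  obtain ⟨L, hL, hKL⟩ := (eq_top_or_exists_le_coatom K).resolve_left hK
  refine ⟨L, hKL, ?_⟩
  have hne : L.index ≠ 1 := fun h => hL.1 (AddSubgroup.index_eq_one.1 h)
  obtain ⟨q, hq, hdvd⟩ := Nat.exists_prime_and_dvd hne
  have := Fact.mk hq
  obtain ⟨x, hx⟩ := exists_prime_addOrderOf_dvd_card' (G := G ⧸ L) q hdvd
  have htop : (AddSubgroup.zmultiples x).comap (QuotientAddGroup.mk' L) = ⊤ := by
    refine hL.2 _ (lt_of_le_of_ne ?_ ?_)
    · intro y hy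
      rw [AddSubgroup.mem_comap, QuotientAddGroup.mk'_apply, (QuotientAddGroup.eq_zero_iff y).2 hy]
      exact zero_mem _
    · intro h
      obtain ⟨y, rfl⟩ := QuotientAddGroup.mk_surjective x
      have hy : y ∈ L := by
        rw [h]
        exact AddSubgroup.mem_zmultiples _
      rw [(QuotientAddGroup.eq_zero_iff y).2 hy, addOrderOf_zero] at hx
      exact hq.one_lt.ne hx
  have hz : AddSubgroup.zmultiples x = ⊤ := by
    rw [eq_top_iff]
    intro z _
    obtain ⟨y, rfl⟩ := QuotientAddGroup.mk_surjective z
    have : y ∈ (AddSubgroup.zmultiples x).comap (QuotientAddGroup.mk' L) := htop ▸ trivial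
    exact this
  have : L.index = q := by
    rw [← hx, ← Nat.card_zmultiples, hz, AddSubgroup.card_top]
    rfl
  rwa [this]

omit [DecidableEq G] in
lemma mem_of_add_self_mem (hodd : Odd (Fintype.card G)) (K : AddSubgroup G) {x : G}
    (h : x + x ∈ K) : x ∈ K := by
  obtain ⟨r, hr⟩ := hodd
  have h1 : Fintype.card G • x = 0 := card_nsmul_eq_zero
  have h2 : x = (r + 1) • (x + x) := by
    have : (r + 1) • (x + x) = Fintype.card G • x + x := by
      rw [hr]; simp only [add_smul, smul_add, mul_smul, two_smul, one_smul]; abel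
    rw [this, h1, zero_add]
  rw [h2]
  exact K.nsmul_mem h _

/-- An isoperimetric inequality: adding a symmetric generating set `C` containing `0` to a
nonempty set increases its size by at least `2 / 3 * #C`, in a group of odd order. -/
theorem three_mul_card_add_le (hodd : Odd (Fintype.card G)) {C : Finset G} (h0 : (0 : G) ∈ C)
    (hneg : ∀ x ∈ C, -x ∈ C) (hgen : ∀ K : AddSubgroup G, (∀ x ∈ C, x ∈ K) → K = ⊤)
    {X : Finset G} (hX : X.Nonempty) (hXC : X + C ≠ univ) :
    3 * #X + 2 * #C ≤ 3 * #(X + C) := by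
  let d : Finset G → ℤ := fun Y => (#(Y + C) : ℤ) - #Y
  let F : Finset (Finset G) := univ.filter fun Y => Y.Nonempty ∧ Y + C ≠ univ
  have hF : ∀ Y, Y ∈ F ↔ Y.Nonempty ∧ Y + C ≠ univ := fun Y => by simp [F]
  obtain ⟨M₀, hM₀F, hM₀⟩ := exists_min_image F d ⟨X, (hF X).2 ⟨hX, hXC⟩⟩
  obtain ⟨M, hMF', hM⟩ := exists_min_image (F.filter fun Y => d Y = d M₀) (fun Y => #Y)
    ⟨M₀, by simp [hM₀F]⟩
  obtain ⟨hMF, hMd⟩ := mem_filter.1 hMF'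
  have hmin : ∀ Y ∈ F, d M ≤ d Y := fun Y hY => hMd ▸ hM₀ Y hY
  have hmin' : ∀ Y ∈ F, d Y ≤ d M → #M ≤ #Y := fun Y hY h =>
    hM Y (mem_filter.2 ⟨hY, hMd ▸ le_antisymm h (hmin Y hY)⟩)
  obtain ⟨hMne, hMC⟩ := (hF M).1 hMF
  have hsize : 2 * (#M : ℤ) + d M ≤ Fintype.card G := by
    have hsub : (M + C)ᶜ + C ⊆ Mᶜ := by
      intro z hz
      obtain ⟨y, hy, c, hc, rfl⟩ := mem_add.1 hz
      rw [mem_compl] at hy ⊢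
      intro hz
      apply hy
      rw [← add_neg_cancel_right y c]
      exact add_mem_add hz (hneg c hc)
    have hYF : (M + C)ᶜ ∈ F := by
      refine (hF _).2 ⟨?_, ?_⟩
      · rw [← compl_ne_univ_iff_nonempty, compl_compl]; exact hMC
      · intro h
        rw [h, univ_subset_iff, compl_eq_univ_iff] at hsub
        exact hMne.ne_empty hsub
    have h1 := card_le_card hsub
    have h2 := card_compl_add_card M
    have h3 := card_compl_add_card (M + C)
    have h4 : d (M + C)ᶜ ≤ d M := by simp only [d]; omega
    have h5 := hmin' _ hYF h4
    simp only [d]; omega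
  have hinter : ∀ M' ∈ F, d M' = d M → #M' = #M → (M ∩ M').Nonempty → M = M' := by
    intro M' hM'F hd hc hne
    have hsub : (M ∩ M') + C ⊆ (M + C) ∩ (M' + C) := inter_add_subset
    have hIF : M ∩ M' ∈ F := by
      refine (hF _).2 ⟨hne, fun h => hMC ?_⟩
      rw [h] at hsub
      exact univ_subset_iff.1 (hsub.trans inter_subset_left)
    have h1 := card_le_card hsub
    have h2 := card_union_add_card_inter (M + C) (M' + C)
    have h3 := card_union_add_card_inter M M'
    have hI := hmin _ hIF
    have hsum : d (M ∩ M') + d (M ∪ M') ≤ 2 * d M := by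
      simp only [d] at hd ⊢
      rw [union_add]
      omega
    have hle : d (M ∩ M') ≤ d M := by
      by_cases hU : (M ∪ M') + C = univ
      · have : d (M ∪ M') = Fintype.card G - #(M ∪ M') := by simp only [d, hU, card_univ]
        have := hne.card_pos
        omega
      · have := hmin (M ∪ M') ((hF _).2 ⟨hMne.mono subset_union_left, hU⟩)
        omega
    have h5 := hmin' _ hIF hle
    have h6 : M ∩ M' = M := eq_of_subset_of_card_le inter_subset_left h5
    exact eq_of_subset_of_card_le (inter_eq_left.1 h6) hc.le
  have htrans : ∀ g : G, g +ᵥ M ∈ F ∧ d (g +ᵥ M) = d M := by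
    intro g
    have h : (g +ᵥ M) + C = g +ᵥ (M + C) := vadd_add_assoc g M C
    refine ⟨(hF _).2 ⟨hMne.vadd_finset, fun h' => hMC ?_⟩, ?_⟩
    · rw [h] at h'
      rw [← card_eq_iff_eq_univ] at h' ⊢
      rwa [card_vadd_finset] at h'
    · simp only [d, h, card_vadd_finset]
  have hsubM : ∀ x ∈ M, ∀ y ∈ M, ∀ z ∈ M, x - y + z ∈ M := by
    intro x hx y hy z hz
    have h := hinter ((x - y) +ᵥ M) (htrans _).1 (htrans _).2 (card_vadd_finset _ _)
      ⟨x, mem_inter.2 ⟨hx, mem_vadd_finset.2 ⟨y, hy, by simp⟩⟩⟩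
    rw [h]
    exact mem_vadd_finset.2 ⟨z, hz, rfl⟩
  obtain ⟨m, hm⟩ := hMne
  let K : AddSubgroup G :=
    { carrier := {x | x + m ∈ M}
      zero_mem' := by simpa using hm
      add_mem' := by
        intro x y hx hy
        have := hsubM _ hx _ hm _ hy
        simp only [Set.mem_ofPred_eq]
        convert this using 1; abel
      neg_mem' := by
        intro x hx
        have := hsubM _ hm _ hx _ hm
        simp only [Set.mem_ofPred_eq]
        convert this using 1; abel }
  have hK : ∀ x, x ∈ K ↔ x + m ∈ M := fun x => Iff.rfl
  have hKtop : K ≠ ⊤ := by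
    intro h
    apply hMC
    rw [eq_univ_iff_forall]
    intro x
    rw [← add_zero x]
    refine add_mem_add ?_ h0
    have : x - m ∈ K := h ▸ trivial
    rwa [hK, sub_add_cancel] at this
  obtain ⟨c, hc, hcK⟩ : ∃ c ∈ C, c ∉ K := by
    by_contra! h
    exact hKtop (hgen K h)
  have hdisj : ∀ u v : G, u - v ∉ K → Disjoint (u +ᵥ M) (v +ᵥ M) := by
    intro u v huv
    rw [disjoint_left]
    intro z hz hz'
    obtain ⟨a, ha, rfl⟩ := mem_vadd_finset.1 hz
    obtain ⟨b, hb, hab⟩ := mem_vadd_finset.1 hz'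
    apply huv
    rw [hK]
    have := hsubM _ hb _ ha _ hm
    convert this using 1
    simp only [vadd_eq_add] at hab
    rw [sub_eq_sub_iff_add_eq_add.2]
    rw [add_comm b v, hab]
  have hsub3 : (M ∪ (c +ᵥ M)) ∪ ((-c) +ᵥ M) ⊆ M + C := by
    refine union_subset (union_subset ?_ ?_) ?_
    · intro x hx; rw [← add_zero x]; exact add_mem_add hx h0
    · intro x hx
      obtain ⟨a, ha, rfl⟩ := mem_vadd_finset.1 hx
      rw [vadd_eq_add, add_comm c a]; exact add_mem_add ha hc
    · intro x hx
      obtain ⟨a, ha, rfl⟩ := mem_vadd_finset.1 hx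
      rw [vadd_eq_add, add_comm (-c) a]; exact add_mem_add ha (hneg c hc)
  have hcard3 : #((M ∪ (c +ᵥ M)) ∪ ((-c) +ᵥ M)) = 3 * #M := by
    have e1 : Disjoint M (c +ᵥ M) := by
      have := hdisj 0 c (by rw [zero_sub]; exact fun h => hcK (by simpa using K.neg_mem h))
      simpa using this
    have e2 : Disjoint M ((-c) +ᵥ M) := by
      have := hdisj 0 (-c) (by simpa using hcK)
      simpa using this
    have e3 : Disjoint (c +ᵥ M) ((-c) +ᵥ M) :=
      hdisj c (-c) (by rw [sub_neg_eq_add]; exact fun h => hcK (mem_of_add_self_mem hodd K h))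
    rw [card_union_of_disjoint (disjoint_union_left.2 ⟨e2, e3⟩), card_union_of_disjoint e1,
      card_vadd_finset, card_vadd_finset]
    ring
  have h3 := card_le_card hsub3
  have hCle : #C ≤ #(M + C) := card_le_card_add_left ⟨m, hm⟩
  have hfin := hmin X ((hF X).2 ⟨hX, hXC⟩)
  simp only [d] at hfin
  omega

/-- The number of elements of `B` that leave `B` under translation by `x`. -/
def leaving (B : Finset G) (x : G) : ℕ := #(B.filter fun y => y + x ∉ B)

omit [Fintype G] in
lemma leaving_add_card_filter (B : Finset G) (x : G) :
    leaving B x + #(B.filter fun y => y + x ∈ B) = #B := by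
  rw [leaving, add_comm]
  exact card_filter_add_card_filter_not (s := B) (fun y => y + x ∈ B)

omit [Fintype G] in
lemma leaving_zero (B : Finset G) : leaving B 0 = 0 := by
  simp [leaving]

omit [Fintype G] in
lemma leaving_neg (B : Finset G) (x : G) : leaving B (-x) = leaving B x := by
  have h : #(B.filter fun y => y + x ∈ B) = #(B.filter fun y => y + -x ∈ B) := by
    refine card_bij' (fun y _ => y + x) (fun y _ => y + -x) ?_ ?_ ?_ ?_ <;> simp +contextual
  have h1 := leaving_add_card_filter B x
  have h2 := leaving_add_card_filter B (-x)
  omega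

omit [Fintype G] in
lemma leaving_add_le (B : Finset G) (x y : G) :
    leaving B (x + y) ≤ leaving B x + leaving B y := by
  have h : #((B.filter fun z => z + (x + y) ∉ B).filter fun z => z + x ∈ B) ≤ leaving B y := by
    refine card_le_card_of_injOn (fun z => z + x) ?_ (fun a _ b _ h => add_right_cancel h)
    intro z hz
    simp only [coe_filter, Set.mem_ofPred_eq, mem_filter] at hz ⊢
    exact ⟨hz.2, by rw [add_assoc]; exact hz.1.2⟩
  have h' : #((B.filter fun z => z + (x + y) ∉ B).filter fun z => z + x ∉ B) ≤ leaving B x := by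
    refine card_le_card ?_
    intro z hz
    simp only [mem_filter] at hz ⊢
    exact ⟨hz.1.1, hz.2⟩
  have := card_filter_add_card_filter_not (s := B.filter fun z => z + (x + y) ∉ B)
    (fun z => z + x ∈ B)
  rw [leaving]
  omega

lemma leaving_compl (B : Finset G) (x : G) : leaving Bᶜ x = leaving B x := by
  rw [← leaving_neg B x]
  refine card_bij' (fun y _ => y + x) (fun y _ => y + -x) ?_ ?_ ?_ ?_ <;> simp +contextual

omit [Fintype G] in
lemma card_union_vadd (B : Finset G) (x : G) : #(B ∪ (x +ᵥ B)) = #B + leaving B x := by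
  rw [← union_sdiff_self_eq_union, card_union_of_disjoint disjoint_sdiff]
  congr 1
  refine (card_bij (fun y _ => x + y) ?_ ?_ ?_).symm
  · intro y hy
    simp only [mem_filter] at hy
    exact mem_sdiff.2 ⟨mem_vadd_finset.2 ⟨y, hy.1, rfl⟩, by rw [add_comm]; exact hy.2⟩
  · intro a _ b _ h
    exact add_left_cancel h
  · intro z hz
    obtain ⟨hz, hzB⟩ := mem_sdiff.1 hz
    obtain ⟨y, hy, rfl⟩ := mem_vadd_finset.1 hz
    exact ⟨y, mem_filter.2 ⟨hy, by rw [add_comm]; exact hzB⟩, rfl⟩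

lemma sum_card_sub_leaving (B : Finset G) :
    ∑ x : G, ((#B : ℤ) - leaving B x) = (#B : ℤ) ^ 2 := by
  have h1 : ∀ x : G, ((#B : ℤ) - leaving B x) = ∑ y ∈ B, if y + x ∈ B then 1 else 0 := by
    intro x
    rw [sum_boole, ← leaving_add_card_filter B x]
    push_cast; ring
  simp_rw [h1]
  rw [sum_comm]
  have h2 : ∀ y ∈ B, (∑ x : G, if y + x ∈ B then (1 : ℤ) else 0) = #B := by
    intro y _
    rw [Fintype.sum_equiv (Equiv.addLeft y) (fun x => if y + x ∈ B then (1 : ℤ) else 0)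
      (fun z => if z ∈ B then 1 else 0) (fun x => rfl)]
    simp
  rw [sum_congr rfl h2]
  simp [sq]

/-- Olson's averaging argument: translations by a generating set move a substantial part of `B`. -/
theorem exists_level_bound (hodd : Odd (Fintype.card G)) {S : Finset G}
    (hgen : ∀ K : AddSubgroup G, (∀ x ∈ S, x ∈ K) → K = ⊤) {B : Finset G} (hB : B.Nonempty)
    (hB2 : 2 * #B ≤ Fintype.card G) {k : ℕ} (hk : ∀ x ∈ S, leaving B x ≤ k) :
    ∃ Q : ℕ, 1 ≤ Q ∧
      3 * (#B : ℤ) ^ 2 ≤ k * (6 * #B * Q - 3 + #S - #S * (Q : ℤ) ^ 2) := by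
  set C : Finset G := insert 0 (S ∪ -S) with hC
  have hb := hB.card_pos
  have h0 : (0 : G) ∈ C := mem_insert_self _ _
  have hSC : S ⊆ C := subset_union_left.trans (subset_insert _ _)
  have hneg : ∀ x ∈ C, -x ∈ C := by
    intro x hx
    simp only [hC, mem_insert, mem_union, mem_neg', neg_neg, neg_eq_zero] at hx ⊢
    tauto
  have hgenC : ∀ K : AddSubgroup G, (∀ x ∈ C, x ∈ K) → K = ⊤ :=
    fun K hK => hgen K fun x hx => hK x (hSC hx)
  have hkC : ∀ x ∈ C, leaving B x ≤ k := by
    intro x hx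
    simp only [hC, mem_insert, mem_union, mem_neg'] at hx
    rcases hx with rfl | hx | hx
    · simp [leaving_zero]
    · exact hk x hx
    · rw [← leaving_neg]; exact hk _ hx
  have hcS : #S ≤ #C := card_le_card hSC
  have hCpos : 0 < #C := card_pos.2 ⟨0, h0⟩
  let I : ℕ → Finset G := fun i => (fun X => X + C)^[i] {0}
  have hI0 : I 0 = {0} := rfl
  have hIs : ∀ i, I (i + 1) = I i + C := fun i => Function.iterate_succ_apply' _ _ _
  have hI1 : I 1 = C := by rw [hIs, hI0, singleton_add]; simp
  have hIsub : ∀ i, I i ⊆ I (i + 1) := by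
    intro i x hx
    rw [hIs, ← add_zero x]
    exact add_mem_add hx h0
  have hIne : ∀ i, (I i).Nonempty := by
    intro i
    induction i with
    | zero => simp [hI0]
    | succ i ih => exact ih.mono (hIsub i)
  have hIstep : ∀ i, #(I (i + 1)) < 2 * #B → 3 * #(I i) + 2 * #C ≤ 3 * #(I (i + 1)) := by
    intro i hi
    rw [hIs] at hi ⊢
    refine three_mul_card_add_le hodd h0 hneg hgenC (hIne i) fun h => ?_
    rw [h, card_univ] at hi
    omega
  have hex : ∃ i, 2 * #B ≤ #(I i) := by
    by_contra! hcon
    have : ∀ i, i ≤ #(I i) := by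
      intro i
      induction i with
      | zero => simp
      | succ i ih => have := hIstep i (hcon _); omega
    exact absurd (this (2 * #B)) (not_le.2 (hcon _))
  have hI0c : #(I 0) = 1 := by simp [hI0]
  obtain ⟨q, hq, hqlt⟩ : ∃ q, 2 * #B ≤ #(I (q + 1)) ∧ ∀ i ≤ q, #(I i) < 2 * #B := by
    obtain ⟨q, hq⟩ : ∃ q, Nat.find hex = q + 1 := by
      refine Nat.exists_eq_succ_of_ne_zero fun h => ?_
      have := Nat.find_spec hex
      rw [h] at this
      omega
    refine ⟨q, hq ▸ Nat.find_spec hex, fun i hi => ?_⟩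
    exact not_le.1 (Nat.find_min hex (by omega))
  have hIcard : ∀ i, i + 1 ≤ q → (2 * ((i + 1 : ℕ) : ℤ) + 1) * #S ≤ 3 * #(I (i + 1)) := by
    intro i
    induction i with
    | zero => intro _; rw [hI1]; push_cast; linarith [(Nat.cast_le (α := ℤ)).2 hcS]
    | succ i ih =>
      intro hi
      have h1 := ih (by omega)
      have h2 := hIstep (i + 1) (hqlt _ hi)
      zify at h2 hcS
      push_cast at h1 ⊢
      linarith
  have hIsum : ∀ j, j ≤ q →
      3 + #S * (((j : ℤ) + 1) ^ 2 - 1) ≤ 3 * ∑ i ∈ range (j + 1), (#(I i) : ℤ) := by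
    intro j
    induction j with
    | zero => intro _; simp [hI0c]
    | succ j ih =>
      intro hj
      have h1 := ih (by omega)
      have h2 := hIcard j hj
      rw [sum_range_succ]
      push_cast at h2 ⊢
      linarith
  have hlev : ∀ j, ∀ x ∈ I j, leaving B x ≤ j * k := by
    intro j
    induction j with
    | zero => intro x hx; rw [hI0, mem_singleton] at hx; simp [hx, leaving_zero]
    | succ j ih =>
      intro x hx
      rw [hIs] at hx
      obtain ⟨y, hy, c, hc, rfl⟩ := mem_add.1 hx
      have h1 := leaving_add_le B y c
      have h2 := ih y hy
      have h3 := hkC c hc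
      rw [add_mul, one_mul]
      omega
  have hlevsum : ∀ j, ∑ x ∈ I j, (leaving B x : ℤ) ≤
      k * (j * #(I j) - ∑ i ∈ range j, (#(I i) : ℤ)) := by
    intro j
    induction j with
    | zero => simp [hI0, leaving_zero]
    | succ j ih =>
      rw [← sum_sdiff (hIsub j), sum_range_succ]
      have h1 : ∑ x ∈ I (j + 1) \ I j, (leaving B x : ℤ) ≤
          #(I (j + 1) \ I j) • (((j + 1 : ℕ) * k : ℕ) : ℤ) :=
        sum_le_card_nsmul _ _ _ fun x hx => by
          exact_mod_cast hlev (j + 1) x (mem_sdiff.1 hx).1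
      have h2 : (#(I (j + 1) \ I j) : ℤ) = #(I (j + 1)) - #(I j) := by
        rw [card_sdiff_of_subset (hIsub j), Nat.cast_sub (card_le_card (hIsub j))]
      rw [nsmul_eq_mul, h2] at h1
      push_cast at h1 ⊢
      nlinarith
  have hmain : ∀ j, (#B : ℤ) * #(I j) - k * (j * #(I j) - ∑ i ∈ range j, (#(I i) : ℤ)) ≤
      (#B : ℤ) ^ 2 := by
    intro j
    rw [← sum_card_sub_leaving B]
    have h1 : ∑ x ∈ I j, ((#B : ℤ) - leaving B x) ≤ ∑ x : G, ((#B : ℤ) - leaving B x) := by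
      refine sum_le_sum_of_subset_of_nonneg (subset_univ _) fun x _ _ => ?_
      have := leaving_add_card_filter B x
      omega
    rw [sum_sub_distrib, sum_const, nsmul_eq_mul] at h1
    have := hlevsum j
    linarith
  have hbound : 2 * (#B : ℤ) * (#B - k * (q + 1)) + k * ∑ i ∈ range (q + 1), (#(I i) : ℤ) ≤
      (#B : ℤ) ^ 2 := by
    rcases le_or_gt ((k : ℤ) * (q + 1)) #B with h | h
    · have h1 := hmain (q + 1)
      zify at hq
      push_cast at h1
      nlinarith
    · have h1 := hmain q
      have h2 := hqlt q le_rfl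
      zify at h2
      rw [sum_range_succ]
      nlinarith
  refine ⟨q + 1, by omega, ?_⟩
  have h1 := hIsum q le_rfl
  have h2 : (0 : ℤ) ≤ k := by positivity
  have h3 := mul_le_mul_of_nonneg_left h1 h2
  push_cast
  linarith

lemma exists_mem_level_bound (hodd : Odd (Fintype.card G)) {S : Finset G} (hS : S.Nonempty)
    (hgen : ∀ K : AddSubgroup G, (∀ x ∈ S, x ∈ K) → K = ⊤) {B : Finset G} (hB : B.Nonempty)
    (hB2 : 2 * #B ≤ Fintype.card G) :
    ∃ x ∈ S, ∃ Q : ℕ, 1 ≤ Q ∧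
      3 * (#B : ℤ) ^ 2 ≤ leaving B x * (6 * #B * Q - 3 + #S - #S * (Q : ℤ) ^ 2) := by
  obtain ⟨x, hx, hmax⟩ := exists_max_image S (leaving B) hS
  exact ⟨x, hx, exists_level_bound hodd hgen hB hB2 hmax⟩

lemma lt_two_mul_of_level_bound {b s k Q : ℤ} (hb : 1 ≤ b) (hk : 0 ≤ k) (hQ : 1 ≤ Q)
    (h : 3 * b ^ 2 ≤ k * (6 * b * Q - 3 + s - s * Q ^ 2)) (hbs : 2 * b ≤ s) : b + 1 ≤ 2 * k := by
  by_contra! hlt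
  have hL : 6 * b * Q - 3 + s - s * Q ^ 2 ≤ 6 * b - 3 := by
    have h1 : (s - 2 * b) * (Q ^ 2 - 1) ≥ 0 := mul_nonneg (by linarith) (by nlinarith)
    have h2 : (Q - 1) * (Q - 2) ≥ 0 := by
      rcases hQ.eq_or_lt with h | h
      · simp [← h]
      · exact mul_nonneg (by linarith) (by linarith)
    nlinarith
  have h3 := mul_le_mul_of_nonneg_left hL hk
  nlinarith

lemma le_four_mul_of_level_bound {b s k Q : ℤ} (hb : 1 ≤ b) (hs : 1 ≤ s) (hQ : 1 ≤ Q)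
    (h : 3 * b ^ 2 ≤ k * (6 * b * Q - 3 + s - s * Q ^ 2)) (hk : 0 ≤ k) (hbs : s ≤ 2 * b) :
    s ≤ 4 * k := by
  by_contra! hlt
  have hLpos : 0 < 6 * b * Q - 3 + s - s * Q ^ 2 := by
    by_contra! hL
    nlinarith [mul_nonneg hk (sub_nonneg.2 hL)]
  have h1 : 12 * b ^ 2 ≤ s * (6 * b * Q - 3 + s - s * Q ^ 2) := by nlinarith
  have h2 : 0 ≤ 12 * b ^ 2 - 6 * s * b * Q + s ^ 2 * (Q ^ 2 - 1) := by
    rcases hQ.eq_or_lt with h | h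
    · rw [← h]; nlinarith
    · nlinarith [sq_nonneg (4 * b - s * Q), mul_nonneg (sq_nonneg s)
        (by nlinarith : (0 : ℤ) ≤ Q ^ 2 - 4)]
  nlinarith

lemma le_ten_mul_of_level_bound {b s k Q : ℤ} (hs : 1 ≤ s)
    (h : 3 * b ^ 2 ≤ k * (6 * b * Q - 3 + s - s * Q ^ 2)) (hk : 0 ≤ k) (hbs : s ≤ b) :
    3 * s ≤ 10 * k := by
  by_contra! hlt
  have hLpos : 0 < 6 * b * Q - 3 + s - s * Q ^ 2 := by
    by_contra! hL
    nlinarith [mul_nonneg hk (sub_nonneg.2 hL)]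
  have h1 : 30 * b ^ 2 ≤ 3 * s * (6 * b * Q - 3 + s - s * Q ^ 2) := by nlinarith
  nlinarith [sq_nonneg (s * Q - 3 * b), mul_self_le_mul_self (by linarith) hbs]

omit [Fintype G] in
lemma card_subsetSum_insert (T : Finset G) {x : G} (hx : x ∉ T) :
    #T.subsetSum + leaving T.subsetSum x ≤ #(insert x T).subsetSum := by
  rw [← card_union_vadd]
  exact card_le_card (union_subset (subsetSum_mono (subset_insert _ _))
    (vadd_finset_subsetSum_subset_subsetSum_insert hx))

/-- One step of the greedy construction: a suitable element of a generating set `S`, disjoint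
from `T`, makes the set of subset sums of `T` grow. -/
lemma exists_insert_subsetSum (hodd : Odd (Fintype.card G)) {S T : Finset G} (hS : S.Nonempty)
    (hST : Disjoint S T) (hgen : ∀ K : AddSubgroup G, (∀ x ∈ S, x ∈ K) → K = ⊤)
    (hT : #T.subsetSum + #S ≤ Fintype.card G) :
    ∃ x ∈ S,
      (2 * #T.subsetSum ≤ #S → 3 * #T.subsetSum + 1 ≤ 2 * #(insert x T).subsetSum) ∧
      (#S ≤ 2 * #T.subsetSum → 4 * #T.subsetSum + #S ≤ 4 * #(insert x T).subsetSum) ∧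
      (#S ≤ #T.subsetSum → 10 * #T.subsetSum + 3 * #S ≤ 10 * #(insert x T).subsetSum) := by
  have hs := hS.card_pos
  have hne : T.subsetSum.Nonempty := subsetSum_nonempty
  have hb := hne.card_pos
  suffices ∃ x ∈ S, (2 * #T.subsetSum ≤ #S → #T.subsetSum + 1 ≤ 2 * leaving T.subsetSum x) ∧
      (#S ≤ 2 * #T.subsetSum → #S ≤ 4 * leaving T.subsetSum x) ∧
      (#S ≤ #T.subsetSum → 3 * #S ≤ 10 * leaving T.subsetSum x) by
    obtain ⟨x, hx, h1, h2, h3⟩ := this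
    have := card_subsetSum_insert T (disjoint_left.1 hST hx)
    exact ⟨x, hx, fun h => by have := h1 h; omega, fun h => by have := h2 h; omega,
      fun h => by have := h3 h; omega⟩
  by_cases hhalf : 2 * #T.subsetSum ≤ Fintype.card G
  · obtain ⟨x, hx, Q, hQ, h⟩ := exists_mem_level_bound hodd hS hgen hne hhalf
    refine ⟨x, hx, fun h' => ?_, fun h' => ?_, fun h' => ?_⟩
    · zify at *; exact lt_two_mul_of_level_bound (by linarith) (by positivity) hQ h h'
    · zify at *; exact le_four_mul_of_level_bound (by linarith) (by linarith) hQ h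
        (by positivity) h'
    · zify at *; exact le_ten_mul_of_level_bound (by linarith) h (by positivity) h'
  · have hc := card_compl_add_card T.subsetSum
    obtain ⟨x, hx, Q, hQ, h⟩ := exists_mem_level_bound hodd hS hgen (B := T.subsetSumᶜ)
      (card_pos.1 (by omega)) (by omega)
    rw [leaving_compl] at h
    have h10 : 3 * #S ≤ 10 * leaving T.subsetSum x := by
      have hle : #S ≤ #T.subsetSumᶜ := by omega
      zify at hle hs ⊢
      exact le_ten_mul_of_level_bound (by linarith) h (by positivity) hle
    exact ⟨x, hx, fun h' => by omega, fun h' => by omega, fun _ => h10⟩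

lemma greedy_step (hodd : Odd (Fintype.card G)) {A : Finset G} {e : ℕ}
    (hgen : ∀ S ⊆ A, e < #S → ∀ K : AddSubgroup G, (∀ x ∈ S, x ∈ K) → K = ⊤)
    (hnot : ∀ T ⊆ A, #T < #A → #T.subsetSum + (#A - #T) ≤ Fintype.card G)
    {T : Finset G} (hTA : T ⊆ A) (hT : e + #T < #A) :
    ∃ T' ⊆ A, #T' = #T + 1 ∧
      (2 * #T.subsetSum ≤ #A - #T → 3 * #T.subsetSum + 1 ≤ 2 * #T'.subsetSum) ∧
      (#A - #T ≤ 2 * #T.subsetSum → 4 * #T.subsetSum + (#A - #T) ≤ 4 * #T'.subsetSum) ∧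
      (#A - #T ≤ #T.subsetSum → 10 * #T.subsetSum + 3 * (#A - #T) ≤ 10 * #T'.subsetSum) := by
  have hc : #(A \ T) = #A - #T := card_sdiff_of_subset hTA
  obtain ⟨x, hx, h⟩ := exists_insert_subsetSum hodd (S := A \ T) (T := T)
    (card_pos.1 (by omega)) sdiff_disjoint (hgen _ sdiff_subset (by omega))
    (by rw [hc]; exact hnot T hTA (by omega))
  rw [hc] at h
  obtain ⟨hxA, hxT⟩ := mem_sdiff.1 hx
  exact ⟨insert x T, insert_subset hxA hTA, card_insert_of_notMem hxT, h⟩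

/-- The greedy construction brings the number of subset sums up to the number of elements of `A`
that are still unused. -/
lemma greedy_start (hodd : Odd (Fintype.card G)) {A : Finset G} {e k : ℕ}
    (hgen : ∀ S ⊆ A, e < #S → ∀ K : AddSubgroup G, (∀ x ∈ S, x ∈ K) → K = ⊤)
    (hnot : ∀ T ⊆ A, #T < #A → #T.subsetSum + (#A - #T) ≤ Fintype.card G)
    (hA : 51 ≤ #A) (hk : #A ≤ 58 + 29 * k) (hke : e + k + 8 ≤ #A) :
    ∃ T ⊆ A, #T = 8 + k ∧ #A - #T ≤ #T.subsetSum := by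
  have hstep := fun {T : Finset G} => greedy_step hodd hgen hnot (T := T)
  obtain ⟨T₁, hT₁, c₁, a₁, -⟩ := hstep (empty_subset A) (by simp; omega)
  have c₀ : #(∅ : Finset G) = 0 := rfl
  have b₀ : #(∅ : Finset G).subsetSum = 1 := rfl
  rw [c₀] at c₁ a₁
  rw [b₀] at a₁
  have b₁ : 2 ≤ #T₁.subsetSum := by omega
  obtain ⟨T₂, hT₂, c₂, a₂, a₂', -⟩ := hstep hT₁ (by omega)
  have b₂ : 4 ≤ #T₂.subsetSum := by omega
  obtain ⟨T₃, hT₃, c₃, a₃, a₃', -⟩ := hstep hT₂ (by omega)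
  have b₃ : 7 ≤ #T₃.subsetSum := by omega
  obtain ⟨T₄, hT₄, c₄, a₄, a₄', -⟩ := hstep hT₃ (by omega)
  have b₄ : 11 ≤ #T₄.subsetSum := by omega
  obtain ⟨T₅, hT₅, c₅, a₅, a₅', -⟩ := hstep hT₄ (by omega)
  have b₅ : 17 ≤ #T₅.subsetSum := by omega
  obtain ⟨T₆, hT₆, c₆, a₆, a₆', -⟩ := hstep hT₅ (by omega)
  have b₆ : 26 ≤ #T₆.subsetSum := by omega
  have hlin : ∀ j ≤ k, ∃ T ⊆ A, #T = 6 + j ∧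
      (26 + 14 * j ≤ #T.subsetSum ∨ #A - #T ≤ 2 * #T.subsetSum) := by
    intro j
    induction j with
    | zero => intro _; exact ⟨T₆, hT₆, by omega, Or.inl (by omega)⟩
    | succ j ih =>
      intro hj
      obtain ⟨T, hT, c, h⟩ := ih (by omega)
      obtain ⟨T', hT', c', h1, h2, -⟩ := hstep hT (by omega)
      exact ⟨T', hT', by omega, by omega⟩
  obtain ⟨T, hT, c, h⟩ := hlin k le_rfl
  obtain ⟨T', hT', c', -, h1, -⟩ := hstep hT (by omega)
  obtain ⟨T'', hT'', c'', -, h2, -⟩ := hstep hT' (by omega)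
  exact ⟨T'', hT'', by omega, by omega⟩

/-- The quadratic growth phase of the greedy construction. -/
lemma greedy_growth (hodd : Odd (Fintype.card G)) {A : Finset G} {e : ℕ}
    (hgen : ∀ S ⊆ A, e < #S → ∀ K : AddSubgroup G, (∀ x ∈ S, x ∈ K) → K = ⊤)
    (hnot : ∀ T ⊆ A, #T < #A → #T.subsetSum + (#A - #T) ≤ Fintype.card G)
    {T₀ : Finset G} (hT₀ : T₀ ⊆ A) (h₀ : #A - #T₀ ≤ #T₀.subsetSum) {s : ℕ}
    (hs : #T₀ + s = #A) {j : ℕ} (hj : e + j ≤ s) :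
    ∃ T ⊆ A, #T = #T₀ + j ∧ #A - #T ≤ #T.subsetSum ∧
      20 * s + 3 * (s * (s + 1)) ≤ 20 * #T.subsetSum + 3 * ((s - j) * (s - j + 1)) := by
  induction j with
  | zero => exact ⟨T₀, hT₀, rfl, h₀, by simp; omega⟩
  | succ j ih =>
    obtain ⟨T, hT, c, h1, h2⟩ := ih (by omega)
    obtain ⟨T', hT', c', -, -, h3⟩ := greedy_step hodd hgen hnot hT (by omega)
    have h4 := h3 h1
    refine ⟨T', hT', by omega, by omega, ?_⟩
    obtain ⟨r, hr⟩ : ∃ r, s - j = r + 1 := ⟨s - j - 1, by omega⟩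
    have hr' : s - (j + 1) = r := by omega
    have hAT : #A - #T = r + 1 := by omega
    rw [hr] at h2
    rw [hr']
    rw [hAT] at h4
    nlinarith

lemma greedy_bound {p e a k : ℤ} (hp : 3 ≤ p) (ha : a + 4 = 2 * e + p) (he : 28 ≤ e)
    (hpe : 11 * p + 1 ≤ 2 * e) (hk : 29 * k ≤ a - 30) :
    20 * (p * (2 * e - 1) - e) + 3 * (e * (e + 1)) <
      20 * (a - 8 - k) + 3 * ((a - 8 - k) * (a - 8 - k + 1)) := by
  have hs : 56 * e + 28 * p - 314 ≤ 29 * (a - 8 - k) := by linarith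
  generalize a - 8 - k = s at hs ⊢
  nlinarith

theorem false_of_generating (hodd : Odd (Fintype.card G)) {A : Finset G} {e p : ℕ}
    (hG : Fintype.card G + p = p * (2 * e)) (hA : #A + 4 = 2 * e + p)
    (hpe : (p = 5 ∧ e = 25) ∨ (3 ≤ p ∧ 28 ≤ e ∧ 11 * p + 1 ≤ 2 * e))
    (hgen : ∀ S ⊆ A, e < #S → ∀ K : AddSubgroup G, (∀ x ∈ S, x ∈ K) → K = ⊤)
    (hnot : ∀ T ⊆ A, #T < #A → #T.subsetSum + (#A - #T) ≤ Fintype.card G) : False := by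
  obtain ⟨k, hk1, hk2⟩ : ∃ k, #A ≤ 58 + 29 * k ∧ 29 * k + 30 ≤ #A :=
    ⟨(#A - 30) / 29, by omega, by omega⟩
  obtain ⟨T₀, hT₀, c₀, h₀⟩ := greedy_start hodd (k := k) hgen hnot (by omega) hk1 (by omega)
  obtain ⟨s, hs⟩ := Nat.exists_eq_add_of_le (card_le_card hT₀)
  obtain ⟨T, hT, c, -, h⟩ := greedy_growth hodd hgen hnot hT₀ h₀ hs.symm (j := s - e) (by omega)
  have hfin := hnot T hT (by omega)
  have hse : s - (s - e) = e := by omega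
  have hsub : #A - #T = e := by omega
  rw [hse] at h
  rw [hsub] at hfin
  have hsA : (s : ℤ) = #A - 8 - k := by omega
  rcases hpe with ⟨rfl, rfl⟩ | ⟨hp, he, hpe⟩
  · have hk0 : k = 0 := by omega
    have : s = 43 := by omega
    subst this
    omega
  · have := greedy_bound (p := p) (e := e) (a := #A) (k := k) (by exact_mod_cast hp)
      (by exact_mod_cast hA) (by exact_mod_cast he) (by exact_mod_cast hpe) (by omega)
    rw [← hsA] at this
    zify at hG hfin h
    nlinarith


omit [Fintype G] in
lemma mem_nss {A : Finset G} {x : G} : x ∈ nss A ↔ ∃ B ⊆ A, B.Nonempty ∧ ∑ b ∈ B, b = x := by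
  simp only [nss, mem_image, mem_erase, mem_powerset, id, ← nonempty_iff_ne_empty]
  exact ⟨fun ⟨B, ⟨h1, h2⟩, h3⟩ => ⟨B, h2, h1, h3⟩, fun ⟨B, h2, h1, h3⟩ => ⟨B, ⟨h1, h2⟩, h3⟩⟩

omit [Fintype G] in
lemma nss_mono {A B : Finset G} (h : A ⊆ B) : nss A ⊆ nss B := fun _ hx => by
  obtain ⟨C, hC, h1, h2⟩ := mem_nss.1 hx
  exact mem_nss.2 ⟨C, hC.trans h, h1, h2⟩

lemma nss_eq_univ_of_subsetSum_erase {A : Finset G} {a : G} (ha : a ∈ A)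
    (h : (A.erase a).subsetSum = univ) : nss A = univ := by
  refine eq_univ_of_forall fun g => mem_nss.2 ?_
  obtain ⟨B, hB, hg⟩ := mem_subsetSum_iff.1 (h ▸ mem_univ (g - a))
  refine ⟨insert a B, insert_subset ha (hB.trans (erase_subset _ _)), insert_nonempty _ _, ?_⟩
  rw [sum_insert fun h' => notMem_erase a A (hB h'), hg, add_sub_cancel]

/-- If the subset sums of a proper subset `T` of `A`, together with the remaining elements of `A`,
are too numerous, then `A` spans. -/
lemma card_subsetSum_add_le {A : Finset G} (h0 : (0 : G) ∉ A) (hns : nss A ≠ univ)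
    {T : Finset G} (hT : T ⊆ A) (hlt : #T < #A) :
    #T.subsetSum + (#A - #T) ≤ Fintype.card G := by
  by_contra! hcon
  have hsd := card_sdiff_add_card_eq_card hT
  obtain ⟨a, ha⟩ : (A \ T).Nonempty := card_pos.1 (by omega)
  obtain ⟨haA, haT⟩ := mem_sdiff.1 ha
  set S := (A \ T).erase a with hS
  have hSA : S ⊆ A.erase a := erase_subset_erase _ sdiff_subset
  have hST : Disjoint T S := disjoint_sdiff.mono_right (erase_subset _ _)
  have hcS : #S + 1 = #A - #T := by
    rw [hS, card_erase_add_one ha]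
    omega
  have hSs : #S + 1 ≤ #S.subsetSum := by
    rw [← card_insert_of_notMem fun h => h0 (mem_of_mem_erase (hSA h))]
    exact card_le_card (insert_subset zero_mem_subsetSum subset_subsetSum)
  refine hns (nss_eq_univ_of_subsetSum_erase haA (eq_univ_of_forall fun g => ?_))
  have hni : ¬ Disjoint T.subsetSum (S.subsetSum.image fun x => g - x) := by
    intro hd
    have h1 := card_le_univ (T.subsetSum ∪ S.subsetSum.image fun x => g - x)
    rw [card_union_of_disjoint hd, card_image_of_injective _ sub_right_injective] at h1
    omega
  obtain ⟨x, hx, hx'⟩ := not_disjoint_iff.1 hni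
  obtain ⟨y, hy, rfl⟩ := mem_image.1 hx'
  obtain ⟨B, hB, hBx⟩ := mem_subsetSum_iff.1 hx
  obtain ⟨C, hC, rfl⟩ := mem_subsetSum_iff.1 hy
  refine mem_subsetSum_iff.2 ⟨B ∪ C, union_subset (fun z hz => mem_erase.2 ⟨?_, hT (hB hz)⟩)
    (hC.trans hSA), ?_⟩
  · rintro rfl
    exact haT (hB hz)
  · rw [sum_union (hST.mono hB hC), hBx, sub_add_cancel]

omit [Fintype G] in
/-- Cauchy-Davenport growth of the image of the subset sums in a group of prime order. -/
lemma card_image_subsetSum {Q : Type*} [AddCommGroup Q] [DecidableEq Q]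
    (hQ : (Nat.card Q).Prime) (φ : G →+ Q) (T₀ T : Finset G) (hT : ∀ x ∈ T, φ x ≠ 0)
    (hd : Disjoint T₀ T) :
    min (Nat.card Q) (#(T₀.subsetSum.image φ) + #T) ≤ #((T₀ ∪ T).subsetSum.image φ) := by
  induction T using Finset.induction_on with
  | empty => simp
  | insert x T hx ih =>
    have ih := ih (fun y hy => hT y (mem_insert_of_mem hy)) (hd.mono_right (subset_insert _ _))
    have hx0 : φ x ≠ 0 := hT x (mem_insert_self _ _)
    have : Finite Q := Nat.finite_of_card_ne_zero hQ.ne_zero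
    set I := (T₀ ∪ T).subsetSum.image φ with hI
    have hxT : x ∉ T₀ ∪ T := by
      rw [mem_union, not_or]
      exact ⟨fun h => disjoint_left.1 hd h (mem_insert_self _ _), hx⟩
    have hsub : I + {0, φ x} ⊆ (T₀ ∪ insert x T).subsetSum.image φ := by
      rw [union_insert, add_subset_iff]
      intro y hy z hz
      obtain ⟨w, hw, rfl⟩ := mem_image.1 hy
      rcases mem_insert.1 hz with rfl | hz
      · rw [add_zero]
        exact mem_image_of_mem _ (subsetSum_mono (subset_insert _ _) hw)
      · rw [mem_singleton.1 hz, ← map_add, add_comm]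
        exact mem_image_of_mem _ (vadd_finset_subsetSum_subset_subsetSum_insert hxT
          (mem_image_of_mem _ hw))
    have hmin : (Nat.card Q : ℕ∞) ≤ AddMonoid.minOrder Q := by
      rw [AddMonoid.le_minOrder_iff_forall_addSubgroup]
      intro s hs _
      have := Fact.mk hQ
      rcases s.eq_bot_or_eq_top_of_prime_card with h | h
      · exact absurd h hs
      · rw [h, AddSubgroup.card_top]
    have hne : I.Nonempty := ⟨φ 0, mem_image_of_mem _ zero_mem_subsetSum⟩
    have hCD := cauchy_davenport_minOrder_add hne (insert_nonempty 0 {φ x})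
    have hpair : #({0, φ x} : Finset Q) = 2 := card_pair hx0.symm
    rw [hpair] at hCD
    have h2 := (min_le_min_right _ hmin).trans hCD
    have h3 : min (Nat.card Q) (#I + 2 - 1) ≤ #(I + {0, φ x}) :=
      min_le_iff.2 ((min_le_iff.1 h2).imp (by exact_mod_cast ·) (by exact_mod_cast ·))
    have h4 := card_le_card hsub
    rw [card_insert_of_notMem hx]
    omega

lemma exists_ne_add_eq (hodd : Odd (Fintype.card G)) {K : AddSubgroup G} {S : Finset G}
    (hS : ∀ x ∈ S, x ∈ K) (hc : Nat.card K + 2 ≤ 2 * #S) {h : G} (hh : h ∈ K) :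
    ∃ x ∈ S, ∃ y ∈ S, x ≠ y ∧ x + y = h := by
  classical
  set S' := S.image fun x => h - x
  have hS'c : #S' = #S := card_image_of_injective _ sub_right_injective
  have hK : #(univ.filter (· ∈ K)) = Nat.card K := by
    rw [Nat.card_eq_fintype_card, Fintype.card_subtype]
  have hsub : S ∪ S' ⊆ univ.filter (· ∈ K) := by
    refine union_subset (fun x hx => by simpa using hS x hx) fun x hx => ?_
    obtain ⟨y, hy, rfl⟩ := mem_image.1 hx
    simpa using K.sub_mem hh (hS y hy)
  have h1 := card_le_card hsub
  have h2 := card_union_add_card_inter S S'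
  obtain ⟨x, hx, y, hy, hxy⟩ := one_lt_card.1 (show 1 < #(S ∩ S') by omega)
  obtain ⟨hxS, hx'⟩ := mem_inter.1 hx
  obtain ⟨hyS, hy'⟩ := mem_inter.1 hy
  obtain ⟨x', hx'S, hx'⟩ := mem_image.1 hx'
  obtain ⟨y', hy'S, hy'⟩ := mem_image.1 hy'
  by_cases hxx : x = x'
  · by_cases hyy : y = y'
    · subst hxx hyy
      refine absurd (sub_eq_zero.1 ((AddSubgroup.mem_bot).1
        (mem_of_add_self_mem hodd ⊥ (x := x - y) ?_))) hxy
      rw [AddSubgroup.mem_bot]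
      have e1 : x + x = h := by rw [← sub_eq_iff_eq_add.1 hx']
      have e2 : y + y = h := by rw [← sub_eq_iff_eq_add.1 hy']
      rw [sub_add_sub_comm, e1, e2, sub_self]
    · exact ⟨y, hyS, y', hy'S, hyy, (sub_eq_iff_eq_add.1 hy').symm⟩
  · exact ⟨x, hxS, x', hx'S, hxx, (sub_eq_iff_eq_add.1 hx').symm⟩

/-- If `A` fills more than half of `K` and the elements of `A` outside `K` have subset sums meeting
every coset of `K`, then `A` spans. -/
lemma nss_eq_univ_of_image_eq_univ (hodd : Odd (Fintype.card G)) {K : AddSubgroup G}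
    {S T : Finset G} (hS : ∀ x ∈ S, x ∈ K) (hT : ∀ x ∈ T, x ∉ K)
    (hc : Nat.card K + 2 ≤ 2 * #S)
    (him : ∀ g : G, ∃ y ∈ T.subsetSum, g - y ∈ K) : nss (S ∪ T) = univ := by
  refine eq_univ_of_forall fun g => mem_nss.2 ?_
  obtain ⟨y, hy, hgy⟩ := him g
  obtain ⟨B, hB, rfl⟩ := mem_subsetSum_iff.1 hy
  obtain ⟨u, hu, v, hv, huv, he⟩ := exists_ne_add_eq hodd hS hc hgy
  have hd : Disjoint {u, v} B := by
    rw [disjoint_left]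
    intro z hz hzB
    rcases mem_insert.1 hz with rfl | hz
    · exact hT _ (hB hzB) (hS _ hu)
    · rw [mem_singleton] at hz
      subst hz
      exact hT _ (hB hzB) (hS _ hv)
  refine ⟨{u, v} ∪ B, union_subset_union ?_ hB, (insert_nonempty u {v}).mono subset_union_left, ?_⟩
  · rw [insert_subset_iff, singleton_subset_iff]
    exact ⟨hu, hv⟩
  · rw [sum_union hd, sum_pair huv, he, sub_add_cancel]

/-- A set that fills more than half of a subgroup `K` of prime index and has subset sums meeting
enough cosets of `K` spans. -/
lemma nss_eq_univ_of_index_le (hodd : Odd (Fintype.card G)) {K : AddSubgroup G}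
    (hK : K.index.Prime) {S T₀ T : Finset G} (hS : ∀ x ∈ S, x ∈ K) (hT₀ : ∀ x ∈ T₀, x ∉ K)
    (hT : ∀ x ∈ T, x ∉ K) (hd : Disjoint T₀ T) (hc : Nat.card K + 2 ≤ 2 * #S)
    {R : Finset G} (hR : R ⊆ T₀.subsetSum) (hRK : ∀ x ∈ R, ∀ y ∈ R, x - y ∈ K → x = y)
    (hidx : K.index ≤ #R + #T) : nss (S ∪ (T₀ ∪ T)) = univ := by
  classical
  refine nss_eq_univ_of_image_eq_univ hodd hS (fun x hx => (mem_union.1 hx).elim (hT₀ x) (hT x))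
    hc fun g => ?_
  have hQ : (Nat.card (G ⧸ K)).Prime := hK
  have h1 := card_image_subsetSum hQ (QuotientAddGroup.mk' K) T₀ T (fun x hx h => hT x hx
    ((QuotientAddGroup.eq_zero_iff x).1 h)) hd
  have h2 : #R ≤ #(T₀.subsetSum.image (QuotientAddGroup.mk' K)) := by
    rw [← card_image_of_injOn (s := R) (f := QuotientAddGroup.mk' K)]
    · exact card_le_card (image_subset_image hR)
    · intro x hx y hy hxy
      refine hRK x hx y hy ((QuotientAddGroup.eq_zero_iff _).1 ?_)
      rw [QuotientAddGroup.mk_sub, sub_eq_zero]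
      exact hxy
  have h3 : Nat.card (G ⧸ K) = K.index := rfl
  have hfin : Fintype (G ⧸ K) := Fintype.ofFinite _
  have h4 : (T₀ ∪ T).subsetSum.image (QuotientAddGroup.mk' K) = univ := by
    rw [← card_eq_iff_eq_univ, ← Nat.card_eq_fintype_card]
    refine le_antisymm ?_ (by omega)
    rw [Nat.card_eq_fintype_card]
    exact card_le_univ _
  obtain ⟨y, hy, hgy⟩ := mem_image.1 (h4 ▸ mem_univ (QuotientAddGroup.mk' K g))
  refine ⟨y, hy, (QuotientAddGroup.eq_zero_iff _).1 ?_⟩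
  rw [QuotientAddGroup.mk_sub, sub_eq_zero]
  exact hgy.symm

omit [DecidableEq G] in
lemma exists_index_eq {p : ℕ} (hp : p.Prime) (hdvd : p ∣ Fintype.card G) :
    ∃ H : AddSubgroup G, H.index = p := by
  have := Fact.mk hp
  obtain ⟨x, hx⟩ := exists_prime_addOrderOf_dvd_card p hdvd
  have hne : (nsmulAddMonoidHom p : G →+ G).range ≠ ⊤ := by
    intro h
    have hinj := Finite.injective_iff_surjective.2 (AddMonoidHom.range_eq_top.1 h)
    have hx0 : x = 0 := by
      refine hinj ?_
      rw [map_zero, nsmulAddMonoidHom_apply, ← hx, addOrderOf_nsmul_eq_zero]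
    rw [hx0, addOrderOf_zero] at hx
    exact hp.one_lt.ne hx
  obtain ⟨L, hL, hLp⟩ := exists_le_prime_index hne
  have := Fact.mk hLp
  obtain ⟨y, hy⟩ := exists_prime_addOrderOf_dvd_card' (G := G ⧸ L) L.index dvd_rfl
  refine ⟨L, (Nat.prime_dvd_prime_iff_eq hLp hp).1 (hy ▸ addOrderOf_dvd_of_nsmul_eq_zero ?_)⟩
  obtain ⟨z, rfl⟩ := QuotientAddGroup.mk_surjective y
  rw [← QuotientAddGroup.mk_nsmul, QuotientAddGroup.eq_zero_iff]
  exact hL ⟨z, rfl⟩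

/-- The standard lower bound for the critical number: a subgroup `H` of prime index without `0`,
together with `H.index - 2` elements of a coset of `H`, does not span. -/
lemma card_add_index_le_cr {H : AddSubgroup G} (hH : H.index.Prime)
    (hle : H.index ≤ Nat.card H + 2) : Nat.card H + H.index ≤ cr G + 2 := by
  classical
  have h2 := hH.two_le
  by_contra! hcon
  have hmem := Nat.sInf_mem (s := {ℓ : ℕ | 0 < ℓ ∧ ∀ A : Finset G, (0 : G) ∉ A → ℓ ≤ #A →
    nss A = univ}) ⟨Fintype.card G, Fintype.card_pos, fun A hA h => by
      rw [(card_eq_iff_eq_univ A).1 (le_antisymm (card_le_univ A) h)] at hA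
      exact absurd (mem_univ _) hA⟩
  obtain ⟨g, hg⟩ : ∃ g, g ∉ H := by
    by_contra! h
    rw [(AddSubgroup.eq_top_iff' H).2 h, AddSubgroup.index_top] at h2
    omega
  set F := univ.filter (· ∈ H) with hF
  have hFc : #F = Nat.card H := by
    rw [Nat.card_eq_fintype_card, Fintype.card_subtype]
  obtain ⟨V, hV, hVc⟩ := exists_subset_card_eq (s := F.image fun x => g + x) (n := H.index - 2) (by
    rw [card_image_of_injective _ (add_right_injective g)]
    omega)
  have hVg : ∀ x ∈ V, x - g ∈ H := fun x hx => by
    obtain ⟨y, hy, rfl⟩ := mem_image.1 (hV hx)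
    simpa [hF] using hy
  have hVH : ∀ x ∈ V, x ∉ H := fun x hx h => hg (by simpa using H.sub_mem h (hVg x hx))
  have h0F : (0 : G) ∈ F := by simp [hF]
  have hd : Disjoint (F.erase 0) V := disjoint_right.2 fun x hx h =>
    hVH x hx (by simpa [hF] using mem_of_mem_erase h)
  have hspan := hmem.2 (F.erase 0 ∪ V) (fun h => (mem_union.1 h).elim (notMem_erase 0 F)
    fun h => hVH 0 h H.zero_mem) (by
      rw [card_union_of_disjoint hd, card_erase_of_mem h0F]
      change cr G ≤ _
      omega)
  obtain ⟨B, hB, -, hBs⟩ := mem_nss.1 (hspan ▸ mem_univ (-g))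
  have hsum : QuotientAddGroup.mk' H (-g) = #(B.filter (· ∈ V)) • QuotientAddGroup.mk' H g := by
    rw [← hBs, map_sum, ← sum_filter_add_sum_filter_not B (· ∈ V), ← sum_const,
      add_eq_left.2 (sum_eq_zero fun x hx => ?_)]
    · refine sum_congr rfl fun x hx => ?_
      rw [← sub_eq_zero, ← map_sub]
      exact (QuotientAddGroup.eq_zero_iff _).2 (hVg x (mem_filter.1 hx).2)
    · obtain ⟨hxB, hxV⟩ := mem_filter.1 hx
      have hxF := mem_of_mem_erase ((mem_union.1 (hB hxB)).resolve_right hxV)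
      exact (QuotientAddGroup.eq_zero_iff _).2 (by simpa [hF] using hxF)
  have hz : (#(B.filter (· ∈ V)) + 1) • QuotientAddGroup.mk' H g = 0 := by
    rw [add_smul, one_smul, ← hsum, map_neg, neg_add_cancel]
  have hord : addOrderOf (QuotientAddGroup.mk' H g) = H.index := by
    refine ((Nat.dvd_prime hH).1 (addOrderOf_dvd_natCard _)).resolve_left fun h => hg ?_
    exact (QuotientAddGroup.eq_zero_iff g).1 (AddMonoid.addOrderOf_eq_one_iff.1 h)
  have hle1 := Nat.le_of_dvd (Nat.succ_pos _) (hord ▸ addOrderOf_dvd_of_nsmul_eq_zero hz)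
  have hle2 : #(B.filter (· ∈ V)) ≤ #V := card_le_card fun x hx => (mem_filter.1 hx).2
  omega

/-- Extremal structure: a non-spanning set containing all nonzero elements of a subgroup `K` of
prime index `p`, and `p - 2` further elements, has these in two opposite cosets of `K`. -/
lemma sub_mem_or_add_mem (hodd : Odd (Fintype.card G)) {K : AddSubgroup G} (hK : K.index.Prime)
    {S T : Finset G} (hS : ∀ x ∈ S, x ∈ K) (hT : ∀ x ∈ T, x ∉ K)
    (hc : Nat.card K + 2 ≤ 2 * #S) (hTc : K.index ≤ #T + 2) (hns : nss (S ∪ T) ≠ univ)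
    {g x : G} (hg : g ∈ T) (hx : x ∈ T) : x - g ∈ K ∨ x + g ∈ K := by
  by_contra! hcon
  obtain ⟨h1, h2⟩ := hcon
  have h1' : g - x ∉ K := fun h => h1 (by simpa using K.neg_mem h)
  have h2' : g + x ∉ K := by rwa [add_comm]
  have hgK := hT g hg
  have hxK := hT x hx
  have hgx : g ≠ x := by
    rintro rfl
    exact h1 (by simp)
  have hsub : {g, x} ⊆ T := by
    rw [insert_subset_iff, singleton_subset_iff]
    exact ⟨hg, hx⟩
  have hR : ({0, g, x, g + x} : Finset G) ⊆ ({g, x} : Finset G).subsetSum := by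
    simp only [insert_subset_iff, singleton_subset_iff]
    refine ⟨zero_mem_subsetSum, subset_subsetSum (by simp), subset_subsetSum (by simp),
      mem_subsetSum_iff.2 ⟨{g, x}, Subset.rfl, sum_pair hgx⟩⟩
  have hRK : ∀ a ∈ ({0, g, x, g + x} : Finset G), ∀ b ∈ ({0, g, x, g + x} : Finset G),
      a - b ∈ K → a = b := by
    simp only [mem_insert, mem_singleton]
    rintro a (rfl | rfl | rfl | rfl) b (rfl | rfl | rfl | rfl) h <;>
    first
    | rfl
    | simp_all only [zero_sub, sub_zero, neg_mem_iff, sub_add_cancel_left, sub_add_cancel_right,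
        add_sub_cancel_left, add_sub_cancel_right, not_true_eq_false]
  have hRc : #({0, g, x, g + x} : Finset G) = 4 := by
    have hg0 : g ≠ 0 := fun h => hgK (h ▸ K.zero_mem)
    have hx0 : x ≠ 0 := fun h => hxK (h ▸ K.zero_mem)
    have hgx0 : g + x ≠ 0 := fun h => h2' (h ▸ K.zero_mem)
    rw [card_insert_of_notMem, card_insert_of_notMem, card_pair] <;>
      simp [hg0, hx0, hgx, hg0.symm, hx0.symm, hgx0.symm]
  have hcT := card_sdiff_add_card_eq_card hsub
  rw [card_pair hgx] at hcT
  refine hns ?_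
  rw [← union_sdiff_of_subset hsub]
  refine nss_eq_univ_of_index_le hodd hK hS (fun y hy => hT y (hsub hy))
    (fun y hy => hT y (mem_sdiff.1 hy).1) disjoint_sdiff hc hR hRK ?_
  omega

lemma add_mul_lt_mul_add (p r j : ℕ) :
    p + r + 1 + p * (j + 2) < (p + r + 1) * (j + 2) + p := by
  nlinarith

lemma composite_bound {p m : ℕ} (hp : p.Prime) (hp2 : p ≠ 2) (hm2 : Odd m)
    (hpm : ∀ q, q.Prime → q ∣ m → p ≤ q) (hm : ¬ m.Prime) (hm1 : m ≠ 1)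
    (hb3 : p = 3 → 62 ≤ m) (hb5 : 5 ≤ p → 7 * p + 3 ≤ m) :
    (p = 5 ∧ m = 49) ∨ (55 ≤ m ∧ 11 * p ≤ m) := by
  have hm2' : ¬ 2 ∣ m := hm2.not_two_dvd_nat
  have hple := hp.two_le
  by_cases hp11 : 11 ≤ p
  · have hm0 : 0 < m := hm2.pos
    have h1 := hpm _ (Nat.minFac_prime hm1) (Nat.minFac_dvd m)
    have h2 := Nat.minFac_sq_le_self hm0 hm
    right
    constructor <;> nlinarith
  · have hpc : p = 3 ∨ p = 5 ∨ p = 7 := by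
      interval_cases p <;> first | omega | (revert hp; norm_num)
    rcases hpc with rfl | rfl | rfl
    · have := hb3 rfl
      omega
    · have := hb5 le_rfl
      by_contra! hcon
      have hm3 : ¬ 3 ∣ m := fun h => absurd (hpm 3 Nat.prime_three h) (by norm_num)
      have : m < 55 := by omega
      interval_cases m <;> first | omega | (revert hm; norm_num)
    · have := hb5 (by norm_num)
      by_contra! hcon
      have hm3 : ¬ 3 ∣ m := fun h => absurd (hpm 3 Nat.prime_three h) (by norm_num)
      have hm5 : ¬ 5 ∣ m := fun h => absurd (hpm 5 Nat.prime_five h) (by norm_num)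
      have : m < 77 := by omega
      interval_cases m <;> first | omega | (revert hm; norm_num)

end Auxiliary

theorem stmt4 {G : Type*} [AddCommGroup G] [Fintype G] [DecidableEq G]
    (hodd : Odd (Fintype.card G)) (hG1 : 1 < Fintype.card G)
    -- `|G|/p` is composite
    (hcomp1 : ¬ (Fintype.card G / (Fintype.card G).minFac).Prime)
    (hcomp2 : Fintype.card G / (Fintype.card G).minFac ≠ 1)
    -- size hypotheses on `|G|/p`
    (hb3 : (Fintype.card G).minFac = 3 → 62 ≤ Fintype.card G / (Fintype.card G).minFac)
    (hb5 : 5 ≤ (Fintype.card G).minFac →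
      7 * (Fintype.card G).minFac + 3 ≤ Fintype.card G / (Fintype.card G).minFac)
    (A : Finset G) (hA0 : (0 : G) ∉ A) (hcard : A.card = cr G - 1)
    (hns : nss A ≠ Finset.univ) :
    ∃ (H : AddSubgroup G) (g : G), g ∉ H ∧
      Nat.card H = Fintype.card G / (Fintype.card G).minFac ∧
      (H : Set G) \ {0} ⊆ (A : Set G) ∧
      (A : Set G) ⊆ (H : Set G) ∪ (fun h => g + h) '' (H : Set G) ∪
        (fun h => -g + h) '' (H : Set G) := by
  classical
  have hp : (Fintype.card G).minFac.Prime := Nat.minFac_prime hG1.ne'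
  have hpdvd := Nat.minFac_dvd (Fintype.card G)
  have hmin : ∀ q, q.Prime → q ∣ Fintype.card G → (Fintype.card G).minFac ≤ q :=
    fun q hq h => Nat.minFac_le_of_dvd hq.two_le h
  have hn : (Fintype.card G).minFac * (Fintype.card G / (Fintype.card G).minFac) =
    Fintype.card G := Nat.mul_div_cancel' hpdvd
  generalize (Fintype.card G).minFac = p at *
  generalize Fintype.card G / p = m at *
  have hodd' := hodd
  rw [← hn, Nat.odd_mul] at hodd'
  have hp2 : p ≠ 2 := by
    rintro rfl
    exact absurd hodd'.1 (by decide)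
  have hbound := composite_bound hp hp2 hodd'.2
    (fun q hq h => hmin q hq (hn ▸ h.mul_left p)) hcomp1 hcomp2 hb3 hb5
  have hp3 : 3 ≤ p := lt_of_le_of_ne hp.two_le hp2.symm
  have hcm : m + p ≤ cr G + 2 := by
    obtain ⟨H, hH⟩ := exists_index_eq hp hpdvd
    have hHc := H.card_mul_index
    rw [hH, Nat.card_eq_fintype_card (α := G), ← hn, mul_comm p] at hHc
    have hHm := Nat.eq_of_mul_eq_mul_right hp.pos hHc
    have := card_add_index_le_cr (H := H) (hH ▸ hp) (by omega)
    omega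
  have hAc : m + p ≤ #A + 3 := by omega
  by_cases hcase : ∃ K : AddSubgroup G, K.index.Prime ∧
      Nat.card K + 2 ≤ 2 * #(A.filter (· ∈ K))
  · obtain ⟨K, hK, hKc⟩ := hcase
    set S := A.filter (· ∈ K) with hSdef
    set T := A.filter (· ∉ K) with hTdef
    have hS : ∀ x ∈ S, x ∈ K := fun x hx => (mem_filter.1 hx).2
    have hT : ∀ x ∈ T, x ∉ K := fun x hx => (mem_filter.1 hx).2
    have hST : S ∪ T = A := filter_union_filter_not_eq _ _
    have hSTc : #S + #T = #A := card_filter_add_card_filter_not _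
    set F := univ.filter (· ∈ K) with hF
    have hFc : #F = Nat.card K := by
      rw [Nat.card_eq_fintype_card, Fintype.card_subtype]
    have hFe : #(F.erase 0) + 1 = #F := card_erase_add_one (by simp [hF])
    have hSF : S ⊆ F.erase 0 := fun x hx => mem_erase.2
      ⟨fun h => hA0 (h ▸ (mem_filter.1 hx).1), by simpa [hF] using hS x hx⟩
    have hSc := card_le_card hSF
    have hTc : #T + 2 ≤ K.index := by
      by_contra! h
      refine hns ?_
      rw [← hST, ← empty_union T]
      exact nss_eq_univ_of_index_le hodd hK (R := {0}) hS (by simp) hT (disjoint_empty_left _) hKc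
        (by simp) (by simp) (by rw [card_singleton]; omega)
    have hKn := K.card_mul_index
    rw [Nat.card_eq_fintype_card (α := G)] at hKn
    have hpq := hmin _ hK (Dvd.intro_left _ hKn)
    have hKp : K.index = p := by
      by_contra hne
      have hdvd : K.index ∣ p * m := hn ▸ Dvd.intro_left _ hKn
      obtain ⟨k, hk⟩ := (hK.dvd_mul.1 hdvd).resolve_left fun h =>
        hne ((Nat.prime_dvd_prime_iff_eq hK hp).1 h)
      have hcK : Nat.card K = p * k := by
        refine Nat.eq_of_mul_eq_mul_right hK.pos ?_
        rw [hKn, ← hn, hk]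
        ring
      have hk1 : k ≠ 1 := by
        rintro rfl
        exact hcomp1 (by rwa [hk, mul_one])
      have hk0 : k ≠ 0 := by
        rintro rfl
        omega
      obtain ⟨r, hr⟩ := Nat.exists_eq_add_of_lt (lt_of_le_of_ne hpq (Ne.symm hne))
      obtain ⟨j, rfl⟩ : ∃ j, k = j + 2 := ⟨k - 2, by omega⟩
      have : m + p ≤ K.index + Nat.card K := by omega
      rw [hk, hcK, hr] at this
      exact absurd this (add_mul_lt_mul_add p r j).not_ge
    have hKm : Nat.card K = m := by
      refine Nat.eq_of_mul_eq_mul_right hp.pos ?_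
      rw [← hKp, hKn, ← hn, hKp, mul_comm]
    have hSeq : S = F.erase 0 := eq_of_subset_of_card_le hSF (by omega)
    obtain ⟨g, hg⟩ : T.Nonempty := card_pos.1 (by omega)
    refine ⟨K, g, hT g hg, hKm, fun x hx => ?_, fun x hx => ?_⟩
    · have : x ∈ S := by
        rw [hSeq]
        exact mem_erase.2 ⟨hx.2, by simpa [hF] using hx.1⟩
      exact (mem_filter.1 this).1
    · by_cases hxK : x ∈ K
      · exact Or.inl (Or.inl hxK)
      · rcases sub_mem_or_add_mem hodd hK hS hT hKc (by omega) (hST ▸ hns) hg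
          (mem_filter.2 ⟨hx, hxK⟩) with h | h
        · exact Or.inl (Or.inr ⟨x - g, h, add_sub_cancel g x⟩)
        · exact Or.inr ⟨x + g, h, by dsimp only; abel⟩
  · push Not at hcase
    exfalso
    obtain ⟨r, rfl⟩ := hodd'.2
    obtain ⟨A', hA', hA'c⟩ := exists_subset_card_eq (s := A) (n := 2 * r + 1 + p - 3) (by omega)
    have hns' : nss A' ≠ univ := fun h => hns (univ_subset_iff.1 (h ▸ nss_mono hA'))
    refine false_of_generating hodd (A := A') (e := r + 1) (p := p) (by rw [← hn]; ring) (by omega)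
      (by omega) (fun S hS hSc K hSK => ?_)
      fun T hT hTc => card_subsetSum_add_le (fun h => hA0 (hA' h)) hns' hT hTc
    by_contra hK
    obtain ⟨L, hKL, hL⟩ := exists_le_prime_index hK
    have h1 := hcase L hL
    have h2 : #S ≤ #(A.filter (· ∈ L)) :=
      card_le_card fun x hx => mem_filter.2 ⟨hA' (hS hx), hKL (hSK x hx)⟩
    have h3 := L.card_mul_index
    rw [Nat.card_eq_fintype_card (α := G)] at h3
    have h4 := hmin _ hL (Dvd.intro_left _ h3)
    have h5 : Nat.card L ≤ 2 * r + 1 := by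
      refine Nat.le_of_mul_le_mul_right (c := p) ?_ hp.pos
      calc Nat.card L * p ≤ Nat.card L * L.index := Nat.mul_le_mul_left _ h4
        _ = (2 * r + 1) * p := by rw [h3, ← hn, mul_comm]
    omega
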